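/- Let m and r be integers with m ≥ 1 and r ≥ 2. Define f_i : ℝ → ℝ by f_i(x) = x^{2m} for 1 ≤ i ≤ r and f_i(x) = −x^{2m} for r+1 ≤ i ≤ 2r. Then for every point (x_1,…,x_{2r}) ∈ ℝ^{2r} with all coordinates nonzero satisfying Σ_{i=1}^{r} x_i^{2m} = Σ_{i=1}^{r} x_{r+i}^{2m}, the separable minimality equation holds: Σ_{j=1}^{2r} (f_j'(x_j))^{-(2m-2)/(2m-1)} f_j''(x_j) · Σ_{i≠j} (f_i'(x_i))^{2m/(2m-1)} = 0. Hence the separable hypersurface Σ_{i=1}^{r} x_i^{2m} − Σ_{i=1}^{r} x_{r+i}^{2m} = 0 in (ℝ^{2r}, ‖·‖_{2m}) is minimal. -/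

import Mathlib

/-- The real `(2m-1)`-th root of `y`: the unique real number `s` with `s^(2m-1) = y`.
For `y ≠ 0`, the fractional power `y^(p/(2m-1))` is interpreted as `(oddRoot m y)^p`. -/
noncomputable def oddRoot (m : ℕ) (y : ℝ) : ℝ :=
  Real.sign y * |y| ^ ((2 * (m : ℝ) - 1)⁻¹)

/-- `oddRoot m` inverts the odd power `s ↦ s ^ (2 * m - 1)`. -/
theorem oddRoot_pow {m : ℕ} (hm : 1 ≤ m) (s : ℝ) : oddRoot m (s ^ (2 * m - 1)) = s := by
  have hodd : Odd (2 * m - 1) := ⟨m - 1, by omega⟩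
  have hcast : (2 * (m : ℝ) - 1) = ((2 * m - 1 : ℕ) : ℝ) := by
    rw [Nat.cast_sub (by omega)]
    push_cast
    ring
  unfold oddRoot
  rw [hcast, abs_pow, Real.pow_rpow_inv_natCast (abs_nonneg s) (by omega)]
  rcases lt_trichotomy s 0 with h | h | h
  · rw [Real.sign_of_neg (hodd.pow_neg_iff.2 h), abs_of_neg h]
    ring
  · simp [h]
  · rw [Real.sign_of_pos (pow_pos h _), abs_of_pos h]
    ring

/-- The sign `+1` on the first `r` indices and `-1` on the others. -/
def halfSign (r : ℕ) (i : ℕ) : ℝ := if i < r then 1 else -1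

theorem halfSign_sq (r i : ℕ) : halfSign r i ^ 2 = 1 := by
  unfold halfSign
  split_ifs <;> norm_num

theorem sum_halfSign (r : ℕ) : ∑ i : Fin (2 * r), halfSign r i = 0 := by
  rw [Fin.sum_univ_eq_sum_range (halfSign r), two_mul, Finset.sum_range_add]
  have h : ∀ i ∈ Finset.range r, halfSign r i = 1 := fun i hi => if_pos (Finset.mem_range.1 hi)
  rw [Finset.sum_congr rfl h]
  simp [halfSign]

/-- Example 6.2: the separable hypersurface
`Σ_{i=1}^{r} x_i^{2m} - Σ_{i=1}^{r} x_{r+i}^{2m} = 0` in `(ℝ^{2r}, ‖·‖_{2m})`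
satisfies the separable minimality equation (6.1) at every point with all
coordinates nonzero; hence it is minimal. -/
theorem example_6_2_minimal (m r : ℕ) (hm : 1 ≤ m) (hr : 2 ≤ r)
    (f : Fin (2 * r) → ℝ → ℝ)
    (hf : ∀ i, ∀ t : ℝ, f i t = if (i : ℕ) < r then t ^ (2 * m) else -t ^ (2 * m))
    (x : Fin (2 * r) → ℝ) (hx : ∀ i, x i ≠ 0)
    (hsum : ∑ i : Fin (2 * r), (if (i : ℕ) < r then (x i) ^ (2 * m) else (0 : ℝ))
        = ∑ i : Fin (2 * r), (if r ≤ (i : ℕ) then (x i) ^ (2 * m) else (0 : ℝ))) :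
    ∑ j, ((oddRoot m (deriv (f j) (x j))) ^ (2 * m - 2))⁻¹
        * deriv (deriv (f j)) (x j)
        * ∑ i ∈ Finset.univ.erase j, (oddRoot m (deriv (f i) (x i))) ^ (2 * m) = 0 := by
  have hf' : ∀ i, f i = fun t => halfSign r i * t ^ (2 * m) := by
    intro i
    funext t
    rw [hf, halfSign]
    split_ifs <;> ring
  have hd : ∀ i, deriv (f i) = fun t => halfSign r i * (2 * m * t ^ (2 * m - 1)) := by
    intro i
    funext t
    rw [hf']
    simp
  have hdd : ∀ i t, deriv (deriv (f i)) t
      = halfSign r i * (2 * m * ((2 * m - 1) * t ^ (2 * m - 2))) := by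
    intro i t
    have h : ((2 * m - 1 : ℕ) : ℝ) = 2 * m - 1 := by
      rw [Nat.cast_sub (by omega)]
      push_cast
      ring
    rw [hd]
    simp [h, Nat.sub_sub]
  obtain ⟨c, hc, hcm⟩ : ∃ c : ℝ, 0 < c ∧ c ^ (2 * m - 1) = 2 * m :=
    ⟨(2 * m : ℝ) ^ (((2 * m - 1 : ℕ) : ℝ)⁻¹), by positivity,
      Real.rpow_inv_natCast_pow (by positivity) (by omega)⟩
  have hroot : ∀ i, oddRoot m (deriv (f i) (x i)) = halfSign r i * (c * x i) := by
    intro i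
    have hs : halfSign r i ^ (2 * m - 1) = halfSign r i := by
      obtain ⟨k, hk⟩ : ∃ k, 2 * m - 1 = 2 * k + 1 := ⟨m - 1, by omega⟩
      rw [hk, pow_succ, pow_mul, halfSign_sq, one_pow, one_mul]
    rw [← oddRoot_pow hm (halfSign r i * (c * x i)), mul_pow, mul_pow, hs, hcm, hd]
  have heven : ∀ (i : Fin (2 * r)) (k : ℕ), (halfSign r i * (c * x i)) ^ (2 * k) = c ^ (2 * k) * x i ^ (2 * k) := by
    intro i k
    rw [mul_pow, mul_pow, pow_mul (halfSign r i), halfSign_sq, one_pow, one_mul]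
  have hbal : ∑ i : Fin (2 * r), halfSign r i * x i ^ (2 * m) = 0 := by
    rw [← sub_eq_zero, ← Finset.sum_sub_distrib] at hsum
    rw [← hsum]
    refine Finset.sum_congr rfl fun i _ => ?_
    by_cases h : (i : ℕ) < r
    · simp [halfSign, h, not_le.2 h]
    · simp [halfSign, h, not_lt.1 h]
  set S := ∑ i, x i ^ (2 * m)
  have hterm : ∀ j, ((oddRoot m (deriv (f j) (x j))) ^ (2 * m - 2))⁻¹
        * deriv (deriv (f j)) (x j)
        * ∑ i ∈ Finset.univ.erase j, (oddRoot m (deriv (f i) (x i))) ^ (2 * m)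
      = (c ^ (2 * m - 2))⁻¹ * (2 * m) * (2 * m - 1) * c ^ (2 * m)
        * (halfSign r j * S - halfSign r j * x j ^ (2 * m)) := by
    intro j
    have hxj : x j ^ (2 * m - 2) ≠ 0 := pow_ne_zero _ (hx j)
    have hS : ∑ i ∈ Finset.univ.erase j, x i ^ (2 * m) = S - x j ^ (2 * m) :=
      Finset.sum_erase_eq_sub (Finset.mem_univ j)
    have he : (halfSign r j * (c * x j)) ^ (2 * m - 2)
        = c ^ (2 * m - 2) * x j ^ (2 * m - 2) := by
      rw [show 2 * m - 2 = 2 * (m - 1) by omega, heven]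
    simp only [hroot, heven, hdd, ← Finset.mul_sum, hS, he]
    field_simp
  rw [Finset.sum_congr rfl fun j _ => hterm j, ← Finset.mul_sum, Finset.sum_sub_distrib,
    ← Finset.sum_mul, sum_halfSign, hbal]
  ring
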